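/- Closure of the constraint algebra for b-deformed 3-constellations: let u₁, u₂, u₃ ∈ K and, in the ring End_K(R)[t] of polynomials in a central variable t with operator coefficients, define for i ≥ 1 the operator L_i := −p_i^* + t·( A_i(3) + e₁(u₁,u₂,u₃)·A_i(2) + e₂(u₁,u₂,u₃)·A_i(1) + e₃(u₁,u₂,u₃)·A_i(0) ), where e_r denotes the r-th elementary symmetric polynomial. Then for all i, j ≥ 1: [L_i, L_j] = t · Σ_{l≥1} ( D_{ij,l}(3) + e₁(u₁,u₂,u₃)·D_{ij,l}(2) ) ∘ L_l (a locally finite sum). In particular the constraint operators of the cubic 3-constellation model are closed under commutation for every value of b. -/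

import Mathlib

noncomputable section

/-- The polynomial ring `K[p₁, p₂, …]`, with one variable `p_i` for each positive integer. -/
abbrev Rp (K : Type) [Field K] : Type := MvPolynomial ℕ+ K

/-- The partial derivative `∂/∂p_i` as a `K`-linear endomorphism (junk value `0` for `i = 0`). -/
def pderivN (K : Type) [Field K] (i : ℕ) : Module.End K (Rp K) :=
  if h : 0 < i then (MvPolynomial.pderiv (⟨i, h⟩ : ℕ+)).toLinearMap else 0

/-- Multiplication by the variable `p_i` (junk value `0` for `i = 0`). -/
def mulpN (K : Type) [Field K] (i : ℕ) : Module.End K (Rp K) :=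
  if h : 0 < i then LinearMap.mulLeft K (MvPolynomial.X (⟨i, h⟩ : ℕ+)) else 0

/-- The operator `p_i^* = i·∂/∂p_i`. -/
def pstar (K : Type) [Field K] (i : ℕ) : Module.End K (Rp K) :=
  (i : K) • pderivN K i

/-- The current operators: `J_{−k}` is multiplication by `p_k` and `J_k = (1+b)·k·∂/∂p_k`
for `k ≥ 1`, and `J₀ = 0`. -/
def Jop (K : Type) [Field K] (b : K) (m : ℤ) : Module.End K (Rp K) :=
  if 0 < m then ((1 + b) * (m : K)) • pderivN K m.toNat else mulpN K (-m).toNat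

/-- The structure operators `D_{ij,l}(s)` of the cubic `3`-constellation model, `0 ≤ s ≤ 3`. -/
def Dcoef (K : Type) [Field K] (b : K) (i j l : ℕ) : ℕ → Module.End K (Rp K)
  | 2 => if (l : ℤ) = (i : ℤ) + (j : ℤ) - 1 then
      ((i : K) - (j : K)) • (1 : Module.End K (Rp K)) else 0
  | 3 =>
      (((i : K) - (j : K)) *
          (2 * (if max i j ≤ l then (1 : K) else 0) +
            (if max i j ≤ l ∧ (l : ℤ) ≤ (i : ℤ) + (j : ℤ) - 1 then (1 : K) else 0)) +
        ((((i : ℤ) - (j : ℤ)).sign : K) *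
            ((2 * (l : ℤ) - 3 * (min i j : ℤ) + 1 : ℤ) : K)) *
          (if min i j ≤ l ∧ l < max i j then (1 : K) else 0)) •
        Jop K b ((i : ℤ) + (j : ℤ) - 1 - (l : ℤ)) +
      (b * ((i : K) - (j : K)) * ((i : K) + (j : K) - 2)) •
        (if (l : ℤ) = (i : ℤ) + (j : ℤ) - 1 then (1 : Module.End K (Rp K)) else 0)
  | _ => 0

/-- A linear operator on `R` acting coefficientwise on elements of `R[t]` (and `R[[t]]`),
the latter being encoded by their coefficient sequences `ℕ → R`. -/
def liftE (K : Type) [Field K] (φ : Module.End K (Rp K)) : Module.End K (ℕ → Rp K) where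
  toFun := fun F n => φ (F n)
  map_add' := fun F G => by funext n; simp
  map_smul' := fun c F => by funext n; simp

/-- Multiplication by the central variable `t`, i.e. the coefficient shift. -/
def tshift (K : Type) [Field K] : Module.End K (ℕ → Rp K) where
  toFun := fun F n => if n = 0 then 0 else F (n - 1)
  map_add' := fun F G => by funext n; by_cases h : n = 0 <;> simp [h]
  map_smul' := fun c F => by funext n; by_cases h : n = 0 <;> simp [h]

/-- The constraint operator
`L_i = −p_i^* + t·(A_i(3) + e₁(u₁,u₂,u₃)·A_i(2) + e₂(u₁,u₂,u₃)·A_i(1) + e₃(u₁,u₂,u₃)·A_i(0))`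
of the cubic `3`-constellation model, an element of `End_K(R)[t]` realized faithfully by its
action on coefficient sequences, the central variable `t` acting as the shift `tshift`. -/
def Lconstr (K : Type) [Field K] (u₁ u₂ u₃ : K) (A : ℕ → ℕ → Module.End K (Rp K)) (i : ℕ) :
    Module.End K (ℕ → Rp K) :=
  liftE K (-pstar K i) +
    tshift K * liftE K (A i 3 + (u₁ + u₂ + u₃) • A i 2 +
      (u₁ * u₂ + u₁ * u₃ + u₂ * u₃) • A i 1 + (u₁ * u₂ * u₃) • A i 0)

section ConstraintAlgebra

open Filter

section Constellation

variable {K V : Type*} [Field K] [AddCommGroup V] [Module K V]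

/-- Operators `J_m` satisfying the Heisenberg relations and operators `A s i` (with `i` counted
from `0`) obtained from them by the constellation recursion, all acting locally finitely. -/
structure IsConstellationSystem [TopologicalSpace V] (b α : K) (J : ℤ → Module.End K V)
    (A : ℕ → ℤ → Module.End K V) : Prop where
  alpha_ne : α ≠ 0
  comm : ∀ m n v, ⁅J m, J n⁆ v = if m + n = 0 then (α * m) • v else 0
  zero : J 0 = 0
  locFin : ∀ v, ∀ᶠ m : ℤ in atTop, J m v = 0
  neg : ∀ s i, i < 0 → A s i = 0
  base_zero : A 0 0 = α⁻¹ • 1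
  base_ne : ∀ i, i ≠ 0 → A 0 i = 0
  hasSum_succ : ∀ i, 0 ≤ i → ∀ s v,
    HasSum (fun n : ℤ => J (i - n) (A s n v)) (A (s + 1) i v - (b * i) • A s i v)

theorem lie_end_apply (X Y : Module.End K V) (v : V) : ⁅X, Y⁆ v = X (Y v) - Y (X v) := rfl

section Discrete

variable [TopologicalSpace V] [DiscreteTopology V] {ι : Type*} {f : ι → V} {x : V}

theorem HasSum.end_apply (h : HasSum f x) (X : Module.End K V) :
    HasSum (fun n => X (f n)) (X x) :=
  h.map X.toAddMonoidHom continuous_of_discreteTopology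

theorem HasSum.smul_discrete (h : HasSum f x) (c : K) :
    HasSum (fun n => c • f n) (c • x) :=
  h.map (DistribSMul.toAddMonoidHom V c) continuous_of_discreteTopology

end Discrete

namespace IsConstellationSystem

variable [TopologicalSpace V] [DiscreteTopology V] {b α : K} {J : ℤ → Module.End K V}
  {A : ℕ → ℤ → Module.End K V}

theorem eventually_eq_zero (h : IsConstellationSystem b α J A) (s : ℕ) (v : V) :
    ∀ᶠ l : ℤ in atTop, A s l v = 0 := by
  induction s with
  | zero =>
    filter_upwards [eventually_gt_atTop 0] with l hl
    rw [h.base_ne l hl.ne']; rfl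
  | succ s ih =>
    obtain ⟨N, hN⟩ := eventually_atTop.1 ih
    have key : ∀ᶠ l : ℤ in atTop, ∀ n ∈ Finset.Ico 0 N, J (l - n) (A s n v) = 0 := by
      rw [eventually_all_finset]
      intro n _
      exact (tendsto_atTop_add_const_right atTop (-n) tendsto_id).eventually
        (h.locFin (A s n v))
    filter_upwards [key, eventually_ge_atTop 0, eventually_ge_atTop N] with l hl h0 hlN
    have hs := h.hasSum_succ l h0 s v
    have hz : (fun n : ℤ => J (l - n) (A s n v)) = fun _ => 0 := by
      funext n
      rcases lt_or_ge n 0 with hn | hn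
      · simp [h.neg s n hn]
      · rcases lt_or_ge n N with hn' | hn'
        · exact hl n (Finset.mem_Ico.2 ⟨hn, hn'⟩)
        · simp [hN n hn']
    rw [hz] at hs
    have := hs.unique hasSum_zero
    rwa [hN l hlN, smul_zero, sub_zero] at this

theorem finite_support (h : IsConstellationSystem b α J A) (s : ℕ) (v : V) :
    (Function.support fun l : ℤ => A s l v).Finite := by
  obtain ⟨N, hN⟩ := eventually_atTop.1 (h.eventually_eq_zero s v)
  refine (Set.finite_Ico 0 N).subset fun l hl => ?_
  constructor
  · by_contra! hneg
    exact hl (by simp [h.neg s l hneg])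
  · by_contra! hge
    exact hl (hN l hge)

theorem A_one (h : IsConstellationSystem b α J A) {i : ℤ} (hi : 0 ≤ i) (v : V) :
    A 1 i v = α⁻¹ • J i v := by
  have hs := h.hasSum_succ i hi 0 v
  have h1 := hasSum_single (f := fun n : ℤ => J (i - n) (A 0 n v)) 0
    (fun n hn => by simp [h.base_ne n hn])
  have h2 := hs.unique h1
  have h3 : (b * i) • A 0 i v = 0 := by
    rcases eq_or_ne i 0 with rfl | hne
    · simp
    · simp [h.base_ne i hne]
  rw [h3, sub_zero] at h2
  simpa [h.base_zero] using h2

theorem A_one_zero (h : IsConstellationSystem b α J A) (v : V) : A 1 0 v = 0 := by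
  simp [h.A_one le_rfl, h.zero]

theorem J_eq (h : IsConstellationSystem b α J A) {i : ℤ} (hi : 0 ≤ i) (v : V) :
    J i v = α • A 1 i v := by
  rw [h.A_one hi, smul_inv_smul₀ h.alpha_ne]

/-- The recursion for commutators with an arbitrary operator. -/
theorem hasSum_lie_succ (h : IsConstellationSystem b α J A) {i : ℤ} (hi : 0 ≤ i) (s : ℕ)
    (X : Module.End K V) (v : V) :
    HasSum (fun n : ℤ => J (i - n) (⁅A s n, X⁆ v) + ⁅J (i - n), X⁆ (A s n v))
      (⁅A (s + 1) i, X⁆ v - (b * i) • ⁅A s i, X⁆ v) := by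
  convert (h.hasSum_succ i hi s (X v)).sub ((h.hasSum_succ i hi s v).end_apply X) using 1
  · funext n
    simp only [lie_end_apply, map_sub]
    abel
  · simp only [lie_end_apply, map_sub, map_smul]
    module

theorem lie_J_A_one (h : IsConstellationSystem b α J A) {j : ℤ} (hj : 0 ≤ j) (m : ℤ) (v : V) :
    ⁅J m, A 1 j⁆ v = if m + j = 0 then (m : K) • v else 0 := by
  have h1 : ⁅J m, A 1 j⁆ v = α⁻¹ • ⁅J m, J j⁆ v := by
    simp only [lie_end_apply, h.A_one hj, map_smul, smul_sub]
  rw [h1, h.comm]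
  split_ifs
  · rw [smul_smul, inv_mul_cancel_left₀ h.alpha_ne]
  · simp

theorem hasSum_lie_J_succ (h : IsConstellationSystem b α J A) {j : ℤ} (hj : 0 ≤ j) (s : ℕ)
    (m : ℤ) (v : V) :
    HasSum (fun n : ℤ => J (j - n) (⁅J m, A s n⁆ v))
      (⁅J m, A (s + 1) j⁆ v - (b * j) • ⁅J m, A s j⁆ v - (α * m) • A s (j + m) v) := by
  have h1 := (h.hasSum_lie_succ hj s (J m) v).neg
  have h2 : HasSum (fun n : ℤ => ⁅J m, J (j - n)⁆ (A s n v)) ((α * m) • A s (j + m) v) := by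
    convert hasSum_single (f := fun n : ℤ => ⁅J m, J (j - n)⁆ (A s n v)) (j + m) ?_ using 1
    · simp [h.comm]
    · intro n hn
      rw [h.comm, if_neg (by omega)]
  convert h1.sub h2 using 1
  · funext n
    simp only [lie_end_apply, map_sub]
    abel
  · simp only [lie_end_apply, smul_sub]
    abel

theorem lie_J_A_two (h : IsConstellationSystem b α J A) {j : ℤ} (hj : 0 ≤ j) (m : ℤ) (v : V) :
    ⁅J m, A 2 j⁆ v =
      ((m * ((if 0 ≤ j + m then 1 else 0) + (if m ≤ 0 then 1 else 0)) : ℤ) : K) • J (j + m) v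
        - (if j + m = 0 then (b * j ^ 2) • v else 0) := by
  have h1 := h.hasSum_lie_J_succ hj 1 m v
  have h2 : HasSum (fun n : ℤ => J (j - n) (⁅J m, A 1 n⁆ v))
      (((if m ≤ 0 then m else 0 : ℤ) : K) • J (j + m) v) := by
    convert hasSum_single (f := fun n : ℤ => J (j - n) (⁅J m, A 1 n⁆ v)) (-m) ?_ using 1
    · split_ifs with hm
      · simp [h.lie_J_A_one (j := -m) (by omega)]
      · simp [h.neg 1 (-m) (by omega), lie_end_apply]
    · intro n hn
      rcases lt_or_ge n 0 with hn0 | hn0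
      · simp [h.neg 1 n hn0, lie_end_apply]
      · rw [h.lie_J_A_one hn0, if_neg (by omega), map_zero]
  have h3 := h1.unique h2
  rw [h.lie_J_A_one hj] at h3
  have h4 : (α * m) • A 1 (j + m) v = ((if 0 ≤ j + m then m else 0 : ℤ) : K) • J (j + m) v := by
    split_ifs with hm
    · rw [h.J_eq hm, smul_smul, mul_comm]
    · simp [h.neg 1 (j + m) (by omega)]
  rw [h4, sub_eq_iff_eq_add, sub_eq_iff_eq_add] at h3
  rw [h3]
  by_cases h0 : j + m = 0
  · obtain rfl : m = -j := by omega
    simp only [neg_add_cancel, add_neg_cancel, if_true, h.zero, LinearMap.zero_apply, smul_zero]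
    push_cast
    module
  · rw [if_neg h0, if_neg (show ¬ m + j = 0 by omega)]
    split_ifs <;> push_cast <;> module

theorem lie_A_one_two (h : IsConstellationSystem b α J A) {i j : ℤ} (hi : 0 ≤ i) (hj : 0 ≤ j)
    (v : V) : ⁅A 1 i, A 2 j⁆ v = (i : K) • A 1 (i + j) v := by
  have h1 : ⁅A 1 i, A 2 j⁆ v = α⁻¹ • ⁅J i, A 2 j⁆ v := by
    simp only [lie_end_apply, h.A_one hi, map_smul, smul_sub]
  rw [h1, h.lie_J_A_two hj, if_pos (by omega), h.A_one (by omega), add_comm j i]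
  have h2 : (if i + j = 0 then (b * (j : K) ^ 2) • v else 0) = 0 := by
    split_ifs with h0
    · obtain rfl : j = 0 := by omega
      simp
    · rfl
  rw [h2, sub_zero]
  rcases eq_or_lt_of_le hi with rfl | hi'
  · simp
  · rw [if_neg (by omega)]
    push_cast
    module

theorem summable_of_forall_eq_zero (h : IsConstellationSystem b α J A) {s : ℕ} {v : V}
    {g : ℤ → V} (hg : ∀ l, A s l v = 0 → g l = 0) : Summable g :=
  summable_of_hasFiniteSupport ((h.finite_support s v).subset fun l hl hA => hl (hg l hA))

theorem summable_coef (h : IsConstellationSystem b α J A) (s : ℕ) (v : V) (k : ℤ) (c : ℤ → ℤ) :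
    Summable fun l : ℤ => ((c l : ℤ) : K) • J (k - l) (A s l v) :=
  h.summable_of_forall_eq_zero (s := s) (v := v) fun l hl => by simp [hl]

/-- Quadratic expressions in commuting `J`'s with antisymmetric coefficients vanish. -/
theorem hasSum_zero_of_antisymm [CharZero K] (h : IsConstellationSystem b α J A) {k : ℤ}
    {e : ℤ → ℤ} (he : ∀ l, 0 < l → l < k → e l + e (k - l) = 0) (he' : ∀ l, k < l → e l = 0)
    (v : V) : HasSum (fun l : ℤ => ((e l : ℤ) : K) • J (k - l) (A 1 l v)) 0 := by
  set g : ℤ → V := fun l => ((e l : ℤ) : K) • J (k - l) (A 1 l v) with hg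
  have H : HasSum g (∑' l, g l) := (h.summable_coef 1 v k e).hasSum
  have H' := (Equiv.subLeft k).hasSum_iff.2 H
  have g_nonpos : ∀ l ≤ 0, g l = 0 := by
    intro l hl
    rcases eq_or_lt_of_le hl with rfl | hl
    · simp [hg, h.A_one_zero]
    · simp [hg, h.neg 1 l hl]
  have g_ge : ∀ l, k ≤ l → g l = 0 := by
    intro l hl
    rcases eq_or_lt_of_le hl with rfl | hl
    · simp [hg, h.zero]
    · simp [hg, he' l hl]
  have hz : (fun l => g l + (g ∘ Equiv.subLeft k) l) = fun _ => 0 := by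
    funext l
    simp only [Function.comp_apply, Equiv.subLeft_apply]
    rcases le_or_gt l 0 with hl | hl
    · rw [g_nonpos l hl, g_ge (k - l) (by omega), add_zero]
    rcases le_or_gt k l with hl' | hl'
    · rw [g_ge l hl', g_nonpos (k - l) (by omega), add_zero]
    have hc := h.comm (k - l) l v
    rw [if_neg (by omega), lie_end_apply, sub_eq_zero] at hc
    have he2 : ((e (k - l) : ℤ) : K) = -((e l : ℤ) : K) := by
      have := he l hl hl'
      exact_mod_cast (by omega : e (k - l) = -e l)
    simp only [hg, h.A_one hl.le, h.A_one (show 0 ≤ k - l by omega), map_smul, hc, he2,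
      sub_sub_cancel]
    module
  have hs := H.add H'
  rw [hz] at hs
  have h2 := hs.unique hasSum_zero
  rw [← two_smul K, smul_eq_zero, or_iff_right two_ne_zero] at h2
  rwa [h2] at H

/-- The coefficients arising from commuting the `J`'s of the recursion with `A 2 j`. -/
def transferCoef (i k l : ℤ) : ℤ :=
  (i - l) * ((if l ≤ k then 1 else 0) + (if i ≤ l then 1 else 0))

theorem lie_J_A_two_sub (h : IsConstellationSystem b α J A) {j : ℤ} (hj : 0 ≤ j) (i l : ℤ)
    (v : V) :
    ⁅J (i - l), A 2 j⁆ v = ((transferCoef i (i + j) l : ℤ) : K) • J (i + j - l) v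
        - (if l = i + j then (b * j ^ 2) • v else 0) := by
  rw [h.lie_J_A_two hj, show j + (i - l) = i + j - l by ring]
  congr 1
  · congr 2
    unfold transferCoef
    split_ifs <;> first | rfl | omega
  · split_ifs <;> first | rfl | omega

theorem hasSum_lie_J_A_two (h : IsConstellationSystem b α J A) {j : ℤ} (hj : 0 ≤ j) (i : ℤ)
    (s : ℕ) (v : V) {q : V}
    (hq : HasSum (fun l : ℤ => ((transferCoef i (i + j) l : ℤ) : K) • J (i + j - l) (A s l v)) q) :
    HasSum (fun l : ℤ => ⁅J (i - l), A 2 j⁆ (A s l v)) (q - (b * j ^ 2) • A s (i + j) v) := by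
  convert hq.sub (hasSum_ite_eq (i + j) ((b * (j : K) ^ 2) • A s (i + j) v)) using 1
  funext l
  rw [h.lie_J_A_two_sub hj]
  congr 1
  split_ifs with hl
  · rw [hl]
  · rfl

theorem lie_A_two_two [CharZero K] (h : IsConstellationSystem b α J A) {i j : ℤ} (hi : 0 ≤ i)
    (hj : 0 ≤ j) (v : V) : ⁅A 2 i, A 2 j⁆ v = ((i : K) - j) • A 2 (i + j) v := by
  have h1 := h.hasSum_lie_succ hi 1 (A 2 j) v
  have hp := (h.summable_coef 1 v (i + j) fun l => if j ≤ l then l - j else 0).hasSum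
  have hq := (h.summable_coef 1 v (i + j) (transferCoef i (i + j))).hasSum
  have hp' := (Equiv.addRight j).hasSum_iff.2 hp
  have h2 := hp'.add (h.hasSum_lie_J_A_two hj i 1 v hq)
  have h3 := h1.unique (h2.congr_fun ?_)
  rotate_left
  · intro n
    simp only [Function.comp_apply, Equiv.coe_addRight]
    congr 1
    rcases lt_or_ge n 0 with hn | hn
    · rw [h.neg 1 n hn, if_neg (by omega)]
      simp [lie_end_apply]
    · rw [h.lie_A_one_two hn hj, map_smul, if_pos (by omega), add_sub_cancel_right,
        show i + j - (n + j) = i - n by ring]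
  have h4 := (h.hasSum_succ (i + j) (by omega) 1 v).smul_discrete ((i : K) - j)
  have h5 := h.hasSum_zero_of_antisymm (k := i + j)
    (e := fun l => (if j ≤ l then l - j else 0) + transferCoef i (i + j) l - (i - j))
    (fun l _ _ => by unfold transferCoef; split_ifs <;> omega)
    (fun l _ => by unfold transferCoef; split_ifs <;> omega) v
  have h6 := (hp.add hq).unique ((h4.add h5).congr_fun fun l => by push_cast; module)
  rw [add_sub, h6, h.lie_A_one_two hi hj] at h3
  rw [sub_eq_iff_eq_add.1 h3]
  push_cast
  module

/-- The coefficients of `⁅A 3 i, A 2 j⁆`. -/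
def crossCoef (i j l : ℤ) : ℤ :=
  (if j ≤ l then l - 2 * j else 0) + transferCoef i (i + j) l

theorem hasSum_lie_A_three_two [CharZero K] (h : IsConstellationSystem b α J A) {i j : ℤ}
    (hi : 0 ≤ i) (hj : 0 ≤ j) (v : V) :
    HasSum (fun l : ℤ => ((crossCoef i j l : ℤ) : K) • J (i + j - l) (A 2 l v))
      (⁅A 3 i, A 2 j⁆ v - (b * (i ^ 2 - i * j - j ^ 2)) • A 2 (i + j) v) := by
  have h1 := h.hasSum_lie_succ hi 2 (A 2 j) v
  have hp := (h.summable_coef 2 v (i + j) fun l => if j ≤ l then l - 2 * j else 0).hasSum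
  have hq := (h.summable_coef 2 v (i + j) (transferCoef i (i + j))).hasSum
  have hp' := (Equiv.addRight j).hasSum_iff.2 hp
  have h2 := hp'.add (h.hasSum_lie_J_A_two hj i 2 v hq)
  have h3 := h1.unique (h2.congr_fun ?_)
  rotate_left
  · intro n
    simp only [Function.comp_apply, Equiv.coe_addRight]
    congr 1
    rcases lt_or_ge n 0 with hn | hn
    · rw [h.neg 2 n hn, if_neg (by omega)]
      simp [lie_end_apply]
    · rw [h.lie_A_two_two hn hj, map_smul, if_pos (by omega),
        show i + j - (n + j) = i - n by ring, show n + j - 2 * j = n - j by ring]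
      push_cast
      rfl
  rw [h.lie_A_two_two hi hj, add_sub, sub_eq_sub_iff_add_eq_add] at h3
  convert (hp.add hq) using 1
  · funext l
    unfold crossCoef
    push_cast
    module
  · rw [sub_eq_iff_eq_add, ← sub_eq_zero]
    rw [← sub_eq_zero] at h3
    rw [← h3]
    module

theorem hasSum_lie_A_one_three (h : IsConstellationSystem b α J A) {i j : ℤ}
    (hi : 0 ≤ i) (hj : 0 ≤ j) (v : V) :
    HasSum (fun l : ℤ => ((if i ≤ l then i else 0 : ℤ) : K) • J (i + j - l) (A 1 l v))
      (⁅A 1 i, A 3 j⁆ v - (b * (i * j)) • A 1 (i + j) v - (i : K) • A 2 (i + j) v) := by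
  have h1 := (h.hasSum_lie_J_succ hj 2 i v).smul_discrete α⁻¹
  have h2 : ∀ s n, α⁻¹ • ⁅J i, A s n⁆ v = ⁅A 1 i, A s n⁆ v := by
    intro s n
    simp only [lie_end_apply, h.A_one hi, map_smul, smul_sub]
  refine (Equiv.addRight i).hasSum_iff.1 ?_
  convert h1 using 1
  · funext n
    simp only [Function.comp_apply, Equiv.coe_addRight]
    rcases lt_or_ge n 0 with hn | hn
    · rw [h.neg 2 n hn, if_neg (by omega)]
      simp [lie_end_apply]
    · rw [if_pos (by omega), ← map_smul (J (j - n)), h2, h.lie_A_one_two hi hn, map_smul,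
        show i + j - (n + i) = j - n by ring, add_comm n i]
  · rw [smul_sub, smul_sub, smul_smul α⁻¹ (α * i), inv_mul_cancel_left₀ h.alpha_ne,
      smul_comm α⁻¹, h2, h2, h.lie_A_one_two hi hj, add_comm j i]
    module

/-- The coefficients of the structure operators of the cubic model. -/
def structCoef (i j l : ℤ) : ℤ :=
  (if j ≤ l then 2 * l - 3 * j else 0) - (if i ≤ l then 2 * l - 3 * i else 0)
    - (if i + j < l then i - j else 0)

/-- Coefficients antisymmetric under `r ↦ i + j - r`. -/
def skewCoef (i j r : ℤ) : ℤ :=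
  (if r ≤ j then j - r else 0) - (if i ≤ r then r - i else 0)

/-- The total coefficient of `J (i + j - l) * J (l - r) * A 2 r` in the difference of the two
sides of the cubic relation. -/
def cubicCoef (i j r l : ℤ) : ℤ :=
  -(if j ≤ l then crossCoef j (l - j) r else 0) + (if i ≤ l then transferCoef i l r else 0)
    + (if r ≤ l ∧ r ≤ i + j then i - r - skewCoef i j r else 0)
    - (if 0 ≤ l then structCoef i j l else 0)

/-- The coefficients of the contraction terms, expressing both the reordering of the `J`'s and
the skew quadratic expression in the `A 2`'s. -/
def diagCoef (j k s : ℤ) : ℤ := if 0 ≤ s ∧ s ≤ j then (2 * s - k) * (j - s) else 0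

set_option maxHeartbeats 4000000 in
theorem cubicCoef_add_reflect {i j r l : ℤ} (hi : 0 ≤ i) (hj : 0 ≤ j) (hr : 0 ≤ r) :
    cubicCoef i j r l + cubicCoef i j r (i + j + r - l) = 0 := by
  have mul_ite_add : ∀ (P Q : Prop) [Decidable P] [Decidable Q] (x : ℤ),
      x * ((if P then 1 else 0) + (if Q then 1 else 0))
        = (if P then x else 0) + (if Q then x else 0) := by
    intros; split_ifs <;> ring
  unfold cubicCoef crossCoef structCoef transferCoef skewCoef
  simp only [mul_ite_add]
  rcases le_or_gt r j with h1 | h1 <;>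
  rcases le_or_gt i r with h2 | h2 <;>
  rcases le_or_gt r l with h3 | h3 <;>
  rcases le_or_gt i l with h4 | h4 <;>
  rcases le_or_gt j l with h5 | h5 <;>
  grind (splits := 30)

theorem cubicCoef_diag {i j : ℤ} (hi : 0 ≤ i) (hj : 0 ≤ j) (l : ℤ) :
    cubicCoef i j (i + j) l * (i + j - l)
      = diagCoef j (i + j) (l - i) + diagCoef j (i + j) (i + j + j - l) := by
  have key : l ≠ i + j → cubicCoef i j (i + j) l
      = (if i ≤ l ∧ l ≤ i + j then 2 * l - 3 * i - j else 0)
        + (if i + j ≤ l ∧ l ≤ i + j + j then 2 * l - i - 3 * j else 0) := by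
    intro hne
    unfold cubicCoef crossCoef structCoef transferCoef skewCoef
    rcases le_or_gt i l with h4 | h4 <;>
    rcases le_or_gt j l with h5 | h5 <;>
    rcases le_or_gt (i + j) l with h6 | h6 <;>
    rcases le_or_gt (i + j + j) l with h7 | h7 <;>
    grind (splits := 30)
  by_cases hne : l = i + j
  · subst hne
    simp [diagCoef]
  · rw [key hne]
    unfold diagCoef
    grind (splits := 30)

theorem skewCoef_mul {i j r : ℤ} (hr : 0 ≤ r) (hr' : r ≤ i + j) :
    skewCoef i j r * (i + j - 2 * r)
      = -diagCoef j (i + j) r - diagCoef j (i + j) (i + j - r) := by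
  unfold skewCoef diagCoef
  grind

theorem skewCoef_reflect (i j r : ℤ) : skewCoef i j (i + j - r) = -skewCoef i j r := by
  unfold skewCoef
  grind

theorem linear_coef {i j l : ℤ} (hi : 0 ≤ i) (hj : 0 ≤ j) :
    -(if j ≤ l then j ^ 2 - j * (l - j) - (l - j) ^ 2 else 0) - i * crossCoef j i l
      + j * transferCoef i (i + j) l - (if i ≤ l then (l - i) ^ 2 else 0)
      + (if l ≤ i + j then (i + j - l) * (i - l - skewCoef i j l) else 0)
      = structCoef i j l * l + (i - j) * (i + j) := by
  unfold crossCoef structCoef transferCoef skewCoef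
  grind

theorem summable_double (h : IsConstellationSystem b α J A) (k : ℤ) {e : ℤ → ℤ → ℤ}
    (he : ∀ r l, 0 ≤ r → l < 0 → e r l = 0) (v : V) :
    Summable fun p : ℤ × ℤ => (e p.1 p.2 : K) • J (k - p.2) (J (p.2 - p.1) (A 2 p.1 v)) := by
  have key : ∀ᶠ l : ℤ in atTop, ∀ r ∈ (h.finite_support 2 v).toFinset,
      J (l - r) (A 2 r v) = 0 := by
    rw [eventually_all_finset]
    intro r _
    exact (tendsto_atTop_add_const_right atTop (-r) tendsto_id).eventually
      (h.locFin (A 2 r v))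
  obtain ⟨N, hN⟩ := eventually_atTop.1 key
  refine summable_of_hasFiniteSupport
    (((h.finite_support 2 v).prod (Set.finite_Ico 0 N)).subset ?_)
  rintro ⟨r, l⟩ hp
  have hA : A 2 r v ≠ 0 := by
    intro hA
    exact hp (by simp [hA])
  have hr : 0 ≤ r := by
    by_contra! hr
    exact hA (by simp [h.neg 2 r hr])
  refine ⟨hA, ?_, ?_⟩
  · by_contra! hl
    exact hp (by simp [he r l hr hl])
  · by_contra! hl
    exact hp (by simp [hN l hl r (by simpa using hA)])

theorem hasSum_double_of_antisymm [CharZero K] (h : IsConstellationSystem b α J A) {k : ℤ}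
    (hk : 0 ≤ k) {e : ℤ → ℤ → ℤ} (he : ∀ r l, 0 ≤ r → l < 0 → e r l = 0)
    (he' : ∀ r l, 0 ≤ r → e r l + e r (k + r - l) = 0) {v z : V}
    (hz : HasSum (fun l : ℤ => (α * ((e k l * (k - l) : ℤ) : K)) • A 2 k v) z) :
    HasSum (fun p : ℤ × ℤ => (e p.1 p.2 : K) • J (k - p.2) (J (p.2 - p.1) (A 2 p.1 v)))
      ((2 : K)⁻¹ • z) := by
  have H := (h.summable_double k he v).hasSum
  set t := ∑' p : ℤ × ℤ, (e p.1 p.2 : K) • J (k - p.2) (J (p.2 - p.1) (A 2 p.1 v))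
  let σ : ℤ × ℤ ≃ ℤ × ℤ :=
    { toFun := fun p => (p.1, k + p.1 - p.2)
      invFun := fun p => (p.1, k + p.1 - p.2)
      left_inv := fun p => by simp
      right_inv := fun p => by simp }
  have H' := H.add (σ.hasSum_iff.2 H)
  have hinj : Function.Injective fun l : ℤ => (k, l) := fun a b hab => by simpa using hab
  have h1 : z = t + t := by
    refine hz.unique ((hinj.hasSum_iff ?_).2 H' |>.congr_fun ?_)
    · rintro ⟨r, l⟩ hp
      simp only [Set.mem_range, Prod.mk.injEq, not_exists, not_and] at hp
      have hrk : r ≠ k := fun hrk => hp l hrk.symm rfl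
      simp only [Function.comp_apply, σ, Equiv.coe_fn_mk]
      rcases lt_or_ge r 0 with hr | hr
      · simp [h.neg 2 r hr]
      have hc := h.comm (k - l) (l - r) (A 2 r v)
      rw [if_neg (by omega), lie_end_apply, sub_eq_zero] at hc
      rw [eq_neg_of_add_eq_zero_right (he' r l hr), show k - (k + r - l) = l - r by ring,
        show k + r - l - r = k - l by ring, hc]
      push_cast
      module
    · intro l
      have hc := h.comm (k - l) (l - k) (A 2 k v)
      rw [if_pos (by ring), lie_end_apply, sub_eq_iff_eq_add] at hc
      simp only [Function.comp_apply, σ, Equiv.coe_fn_mk]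
      rw [eq_neg_of_add_eq_zero_right (he' k l hk), show k - (k + k - l) = l - k by ring,
        show k + k - l - k = k - l by ring, hc]
      push_cast
      module
  rw [h1, ← two_smul K, inv_smul_smul₀ two_ne_zero]
  exact H

theorem hasSum_fiber_snd {k : ℤ} {e : ℤ → ℤ → ℤ} {v t : V} {w : ℤ → V}
    (ht : HasSum (fun p : ℤ × ℤ => (e p.1 p.2 : K) • J (k - p.2) (J (p.2 - p.1) (A 2 p.1 v))) t)
    (hw : ∀ l, HasSum (fun r => (e r l : K) • J (l - r) (A 2 r v)) (w l)) :
    HasSum (fun l => J (k - l) (w l)) t := by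
  refine ((Equiv.prodComm ℤ ℤ).hasSum_iff.2 ht).prod_fiberwise fun l => ?_
  convert (hw l).end_apply (J (k - l)) using 1
  funext r
  simp

/-- The commutators with `A 3 j` in the recursion for `A 3 i`, first kind. -/
theorem hasSum_J_lie_A_two_three [CharZero K] (h : IsConstellationSystem b α J A) {i j : ℤ}
    (hj : 0 ≤ j) {v t s : V}
    (ht : HasSum (fun p : ℤ × ℤ => ((if j ≤ p.2 then crossCoef j (p.2 - j) p.1 else 0 : ℤ) : K) •
      J (i + j - p.2) (J (p.2 - p.1) (A 2 p.1 v))) t)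
    (hs : HasSum (fun l : ℤ => ((if j ≤ l then j ^ 2 - j * (l - j) - (l - j) ^ 2 else 0 : ℤ) : K) •
      J (i + j - l) (A 2 l v)) s) :
    HasSum (fun n => J (i - n) (⁅A 2 n, A 3 j⁆ v)) (-t - b • s) := by
  have h1 := hasSum_fiber_snd (e := fun r l => if j ≤ l then crossCoef j (l - j) r else 0)
    (w := fun l => if j ≤ l then ⁅A 3 j, A 2 (l - j)⁆ v
      - (b * (j ^ 2 - j * (l - j) - (l - j) ^ 2)) • A 2 l v else 0) ht fun l => ?_
  · have h2 := (Equiv.addRight j).hasSum_iff.2 (h1.neg.sub (hs.smul_discrete b))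
    refine h2.congr_fun fun n => ?_
    simp only [Function.comp_apply, Equiv.coe_addRight, add_sub_cancel_right,
      show i + j - (n + j) = i - n by ring]
    rcases lt_or_ge n 0 with hn | hn
    · simp [h.neg 2 n hn, lie_end_apply, hn.not_ge]
    · rw [if_pos (by omega), if_pos (by omega), map_sub, map_smul,
        show ⁅A 3 j, A 2 n⁆ v = -⁅A 2 n, A 3 j⁆ v by simp [lie_end_apply], map_neg]
      push_cast
      module
  · by_cases hl : j ≤ l
    · simp only [if_pos hl]
      have := h.hasSum_lie_A_three_two hj (show 0 ≤ l - j by omega) v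
      rw [show j + (l - j) = l by ring] at this
      push_cast at this ⊢
      exact this
    · simp only [if_neg hl]
      simp

/-- The commutators with `A 3 j` in the recursion for `A 3 i`, second kind. -/
theorem hasSum_lie_J_A_three [CharZero K] (h : IsConstellationSystem b α J A) {i j : ℤ}
    (hj : 0 ≤ j) {v t s q p : V}
    (ht : HasSum (fun p : ℤ × ℤ => ((if i ≤ p.2 then transferCoef i p.2 p.1 else 0 : ℤ) : K) •
      J (i + j - p.2) (J (p.2 - p.1) (A 2 p.1 v))) t)
    (hs : HasSum (fun l : ℤ => ((if i ≤ l then (l - i) ^ 2 else 0 : ℤ) : K) •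
      J (i + j - l) (A 2 l v)) s)
    (hq : HasSum (fun l : ℤ => ((transferCoef i (i + j) l : ℤ) : K) • J (i + j - l) (A 2 l v)) q)
    (hp : HasSum (fun r : ℤ => (α * (i - r)) • A 2 (i + j - r) (A 2 r v)) p) :
    HasSum (fun r => ⁅J (i - r), A 3 j⁆ (A 2 r v))
      (t - b • s + p + (b * j) • (q - (b * j ^ 2) • A 2 (i + j) v)) := by
  have h1 := HasSum.prod_fiberwise ht (g := fun r => ⁅J (i - r), A 3 j⁆ (A 2 r v)
    - (b * j) • ⁅J (i - r), A 2 j⁆ (A 2 r v) - (α * (i - r)) • A 2 (i + j - r) (A 2 r v)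
    + b • ((if i ≤ r then (r - i) ^ 2 else 0 : ℤ) : K) • J (i + j - r) (A 2 r v)) fun r => ?_
  · have h2 := ((h1.sub (hs.smul_discrete b)).add hp).add
      ((h.hasSum_lie_J_A_two hj i 2 v hq).smul_discrete (b * j))
    refine h2.congr_fun fun n => ?_
    abel
  · set w := A 2 r v
    have h3 := h.hasSum_lie_J_succ hj 2 (i - r) w
    have h4 : HasSum (fun n : ℤ => if n = r - i then
        b • ((if i ≤ r then (r - i) ^ 2 else 0 : ℤ) : K) • J (i + j - r) w else 0) _ :=
      hasSum_ite_eq _ _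
    refine (Equiv.addRight i).hasSum_iff.1 ?_
    convert h3.add h4 using 1
    · funext n
      simp only [Function.comp_apply, Equiv.coe_addRight]
      rcases lt_or_ge n 0 with hn | hn
      · rw [if_neg (by omega), h.neg 2 n hn]
        by_cases hnr : n = r - i
        · rw [if_pos hnr, if_neg (by omega)]
          simp [lie_end_apply]
        · rw [if_neg hnr]
          simp [lie_end_apply]
      · rw [if_pos (by omega), h.lie_J_A_two_sub hn, show i + j - (n + i) = j - n by ring,
          add_comm n i, map_sub, map_smul]
        by_cases hnr : n = r - i
        · rw [if_pos hnr, if_pos (by omega), if_pos (by omega), map_smul,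
            show i + j - r = j - n by omega, show (r - i) = n by omega]
          push_cast
          module
        · rw [if_neg hnr, if_neg (by omega)]
          simp [w]
    · push_cast
      rw [show j + (i - r) = i + j - r by ring]

theorem hasSum_alpha_A_two (h : IsConstellationSystem b α J A) {k : ℤ} (hk : 0 ≤ k) (w : V) :
    HasSum (fun n : ℤ => ((if 0 ≤ n then 1 else 0 : ℤ) : K) • J (k - n) (J n w))
      (α • A 2 k w - (b * k) • J k w) := by
  convert (h.hasSum_succ k hk 1 w).smul_discrete α using 1
  · funext n
    split_ifs with hn
    · rw [h.J_eq hn, map_smul, Int.cast_one, one_smul]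
    · simp [h.neg 1 n (by omega)]
  · rw [h.J_eq hk]
    module

theorem hasSum_A_two_A_two (h : IsConstellationSystem b α J A) {k : ℤ} {v t s : V} (c : ℤ → ℤ)
    (ht : HasSum (fun p : ℤ × ℤ => ((if p.1 ≤ p.2 ∧ p.1 ≤ k then c p.1 else 0 : ℤ) : K) •
      J (k - p.2) (J (p.2 - p.1) (A 2 p.1 v))) t)
    (hs : HasSum (fun l : ℤ => ((if l ≤ k then (k - l) * c l else 0 : ℤ) : K) •
      J (k - l) (A 2 l v)) s) :
    HasSum (fun r : ℤ => (α * c r) • A 2 (k - r) (A 2 r v)) (t + b • s) := by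
  have h1 := HasSum.prod_fiberwise ht (g := fun r => (α * c r) • A 2 (k - r) (A 2 r v)
    - b • ((if r ≤ k then (k - r) * c r else 0 : ℤ) : K) • J (k - r) (A 2 r v)) fun r => ?_
  · refine (h1.add (hs.smul_discrete b)).congr_fun fun r => ?_
    abel
  · set w := A 2 r v
    by_cases hr : r ≤ k
    · have h2 := (h.hasSum_alpha_A_two (show 0 ≤ k - r by omega) w).smul_discrete (c r : K)
      refine (Equiv.addRight r).hasSum_iff.1 ?_
      convert h2 using 1
      · funext n
        simp only [Function.comp_apply, Equiv.coe_addRight]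
        rw [show k - (n + r) = k - r - n by ring, add_sub_cancel_right]
        by_cases hn : 0 ≤ n
        · rw [if_pos hn, if_pos (by omega)]
          simp [w]
        · rw [if_neg hn, if_neg (by omega)]
          simp
      · rw [if_pos hr]
        push_cast
        module
    · simp only [hr, and_false, if_false, h.neg 2 (k - r) (by omega)]
      simp

theorem hasSum_structCoef_A_three (h : IsConstellationSystem b α J A) {i j : ℤ} {v t s : V}
    (ht : HasSum (fun p : ℤ × ℤ => ((if 0 ≤ p.2 then structCoef i j p.2 else 0 : ℤ) : K) •
      J (i + j - p.2) (J (p.2 - p.1) (A 2 p.1 v))) t)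
    (hs : HasSum (fun l : ℤ => ((structCoef i j l * l : ℤ) : K) • J (i + j - l) (A 2 l v)) s) :
    HasSum (fun l : ℤ => ((structCoef i j l : ℤ) : K) • J (i + j - l) (A 3 l v)) (t + b • s) := by
  have h1 := hasSum_fiber_snd (e := fun _ l => if 0 ≤ l then structCoef i j l else 0)
    (w := fun l => (structCoef i j l : K) • (A 3 l v - (b * l) • A 2 l v)) ht fun l => ?_
  · refine (h1.add (hs.smul_discrete b)).congr_fun fun l => ?_
    simp only [map_sub, map_smul]
    push_cast
    module
  · by_cases hl : 0 ≤ l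
    · simp only [if_pos hl]
      exact (h.hasSum_succ l hl 2 v).smul_discrete _
    · simp [hl, h.neg _ l (not_le.1 hl)]

theorem summable_diagCoef (k j : ℤ) (c : K) (w : V) :
    Summable fun l : ℤ => (c * ((diagCoef j k l : ℤ) : K)) • w := by
  refine summable_of_hasFiniteSupport ((Set.finite_Icc 0 j).subset fun l hl => ?_)
  by_contra hl'
  exact hl (by simp [diagCoef, if_neg (show ¬(0 ≤ l ∧ l ≤ j) from hl')])

/-- The skew quadratic expression in the `A 2`'s cancels the contraction terms. -/
theorem skew_cubic_cancel [CharZero K] (h : IsConstellationSystem b α J A) {i j : ℤ} (hi : 0 ≤ i)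
    (hj : 0 ≤ j) {v t y : V}
    (ht : HasSum (fun p : ℤ × ℤ => ((cubicCoef i j p.1 p.2 : ℤ) : K) •
      J (i + j - p.2) (J (p.2 - p.1) (A 2 p.1 v))) t)
    (hy : HasSum (fun r : ℤ => (α * (skewCoef i j r : K)) • A 2 (i + j - r) (A 2 r v)) y) :
    t + y = 0 := by
  set k := i + j with hk
  have hu := (summable_diagCoef k j α (A 2 k v)).hasSum
  set u := ∑' l : ℤ, (α * ((diagCoef j k l : ℤ) : K)) • A 2 k v
  have hu2 := (Equiv.subLeft k).hasSum_iff.2 hu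
  have h1 : t = (2 : K)⁻¹ • (u + u) := by
    refine ht.unique (h.hasSum_double_of_antisymm (by omega) ?_ ?_ ?_)
    · intro r l hr hl
      unfold cubicCoef
      rw [if_neg (by omega), if_neg (by omega), if_neg (by omega), if_neg (by omega)]
      rfl
    · exact fun r l hr => cubicCoef_add_reflect hi hj hr
    · refine (((Equiv.subRight i).hasSum_iff.2 hu).add
        ((Equiv.subLeft (k + j)).hasSum_iff.2 hu)).congr_fun fun l => ?_
      simp only [Function.comp_apply, Equiv.subRight_apply, Equiv.subLeft_apply]
      rw [hk, cubicCoef_diag hi hj]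
      push_cast
      module
  have h2 : y + y = -u - u := by
    refine (hy.add ((Equiv.subLeft k).hasSum_iff.2 hy)).unique
      ((hu.neg.sub hu2).congr_fun fun r => ?_)
    simp only [Function.comp_apply, Equiv.subLeft_apply, sub_sub_cancel]
    by_cases hr : 0 ≤ r ∧ r ≤ k
    · have h3 := h.lie_A_two_two (show 0 ≤ k - r by omega) hr.1 v
      rw [lie_end_apply, sub_eq_iff_eq_add, sub_add_cancel] at h3
      have h4 := congrArg (Int.cast (R := K)) (skewCoef_mul (i := i) hr.1 hr.2)
      rw [h3, skewCoef_reflect]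
      push_cast [← hk] at h4 ⊢
      have h5 : (skewCoef i j r : K) * (k - 2 * r) = -diagCoef j k r - diagCoef j k (k - r) := by
        rw [← h4, hk]
      linear_combination (norm := module) (α * h5) • A 2 k v
    · have h3 : A 2 (k - r) (A 2 r v) = 0 ∧ A 2 r (A 2 (k - r) v) = 0 := by
        rcases lt_or_ge r 0 with hr0 | hr0
        · simp [h.neg 2 r hr0]
        · simp [h.neg 2 (k - r) (by omega)]
      have h4 : diagCoef j k r = 0 ∧ diagCoef j k (k - r) = 0 := by
        unfold diagCoef
        grind
      simp [h3, h4]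
  have h3 : (2 : K) • (t + y) = 0 := by
    rw [h1, smul_add, smul_inv_smul₀ two_ne_zero, two_smul K y, h2]
    abel
  exact (smul_eq_zero.1 h3).resolve_left two_ne_zero

theorem hasSum_lie_A_three_three [CharZero K] (h : IsConstellationSystem b α J A) {i j : ℤ}
    (hi : 0 ≤ i) (hj : 0 ≤ j) (v : V) :
    HasSum (fun l : ℤ => ((structCoef i j l : ℤ) : K) • J (i + j - l) (A 3 l v))
      (⁅A 3 i, A 3 j⁆ v - (b * ((i - j) * (i + j))) • A 3 (i + j) v) := by
  obtain ⟨t1, T1⟩ := (h.summable_double (i + j) (v := v)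
    (e := fun r l => if j ≤ l then crossCoef j (l - j) r else 0)
    (fun r l _ hl => if_neg (by omega)))
  obtain ⟨t2, T2⟩ := (h.summable_double (i + j) (v := v)
    (e := fun r l => if i ≤ l then transferCoef i l r else 0)
    (fun r l _ hl => if_neg (by omega)))
  obtain ⟨t3, T3⟩ := (h.summable_double (i + j) (v := v)
    (e := fun r l => if r ≤ l ∧ r ≤ i + j then i - r - skewCoef i j r else 0)
    (fun r l _ hl => if_neg (by omega)))
  obtain ⟨t4, T4⟩ := (h.summable_double (i + j) (v := v)
    (e := fun r l => if 0 ≤ l then structCoef i j l else 0)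
    (fun r l _ hl => if_neg (by omega)))
  obtain ⟨s1, S1⟩ := (h.summable_coef 2 v (i + j)
    fun l => if j ≤ l then j ^ 2 - j * (l - j) - (l - j) ^ 2 else 0)
  obtain ⟨s2, S2⟩ := (h.summable_coef 2 v (i + j) fun l => if i ≤ l then (l - i) ^ 2 else 0)
  obtain ⟨s3, S3⟩ := (h.summable_coef 2 v (i + j)
    fun l => if l ≤ i + j then (i + j - l) * (i - l - skewCoef i j l) else 0)
  obtain ⟨s4, S4⟩ := (h.summable_coef 2 v (i + j) fun l => structCoef i j l * l)
  obtain ⟨q, Q⟩ := (h.summable_coef 2 v (i + j) (transferCoef i (i + j)))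
  obtain ⟨y, Y⟩ := (h.summable_of_forall_eq_zero (s := 2) (v := v)
    (g := fun r => (α * (skewCoef i j r : K)) • A 2 (i + j - r) (A 2 r v))
    (fun l hl => by simp [hl]))
  have S6 := h.hasSum_succ (i + j) (by omega) 2 v
  have P := (h.hasSum_A_two_A_two (fun r => i - r - skewCoef i j r) T3 S3).add Y
  have I1 := h.hasSum_J_lie_A_two_three hj T1 S1
  have I2 := h.hasSum_lie_J_A_three hj T2 S2 Q (P.congr_fun fun r => by push_cast; module)
  have S5 := h.hasSum_lie_A_three_two hj hi v
  have E := (h.hasSum_lie_succ hi 2 (A 3 j) v).unique (I1.add I2)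
  have R := h.skew_cubic_cancel hi hj
    ((((T1.neg.add T2).add T3).sub T4).congr_fun fun p => by unfold cubicCoef; push_cast; module) Y
  have L := (((((S1.neg.sub (S5.smul_discrete (i : K))).add (Q.smul_discrete (j : K))).sub
    S2).add S3)).unique ((S4.add (S6.smul_discrete (((i - j) * (i + j) : ℤ) : K))).congr_fun
      fun l => by
        have := congrArg (Int.cast (R := K)) (linear_coef (l := l) hi hj)
        rw [add_comm j i]
        push_cast at this ⊢
        linear_combination (norm := module) this • J (i + j - l) (A 2 l v))
  have F := h.hasSum_structCoef_A_three T4 S4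
  convert F using 1
  have E5 : ⁅A 3 j, A 2 i⁆ v = -⁅A 2 i, A 3 j⁆ v := by simp [lie_end_apply]
  rw [E5, add_comm j i] at L
  push_cast at L
  rw [sub_eq_iff_eq_add] at E ⊢
  rw [show (3 : ℕ) = 2 + 1 from rfl] at *
  rw [E]
  linear_combination (norm := module) R + b • L

theorem hasSum_structCoef_A_two [CharZero K] (h : IsConstellationSystem b α J A) {i j : ℤ}
    (hi : 0 ≤ i) (hj : 0 ≤ j) (v : V) :
    HasSum (fun l : ℤ => ((structCoef i j l : ℤ) : K) • J (i + j - l) (A 2 l v))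
      (⁅A 3 i, A 2 j⁆ v + ⁅A 2 i, A 3 j⁆ v - ((i : K) - j) • A 3 (i + j) v
        - (b * ((i - j) * (i + j))) • A 2 (i + j) v) := by
  have h1 := h.hasSum_lie_A_three_two hi hj v
  have h2 := h.hasSum_lie_A_three_two hj hi v
  have h3 := (h.hasSum_succ (i + j) (by omega) 2 v).smul_discrete ((i : K) - j)
  have h4 : ⁅A 3 j, A 2 i⁆ v = -⁅A 2 i, A 3 j⁆ v := by simp [lie_end_apply]
  rw [h4, add_comm j i] at h2
  convert (h1.sub h2).sub h3 using 1
  · funext l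
    have h5 : structCoef i j l = crossCoef i j l - crossCoef j i l - (i - j) := by
      unfold structCoef crossCoef transferCoef
      grind
    rw [h5]
    push_cast
    module
  · push_cast
    module

theorem hasSum_structCoef_A_one [CharZero K] (h : IsConstellationSystem b α J A) {i j : ℤ}
    (hi : 0 ≤ i) (hj : 0 ≤ j) (v : V) :
    HasSum (fun l : ℤ => ((structCoef i j l : ℤ) : K) • J (i + j - l) (A 1 l v))
      (⁅A 3 i, A 1 j⁆ v + ⁅A 1 i, A 3 j⁆ v
        - (b * ((i - j) * (i + j))) • A 1 (i + j) v) := by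
  have h1 := h.hasSum_lie_A_one_three hi hj v
  have h2 := h.hasSum_lie_A_one_three hj hi v
  have h3 := (h.hasSum_succ (i + j) (by omega) 1 v).smul_discrete ((i : K) - j)
  have h4 : ⁅A 1 j, A 3 i⁆ v = -⁅A 3 i, A 1 j⁆ v := by simp [lie_end_apply]
  have h5 := h.hasSum_zero_of_antisymm (k := i + j)
    (e := fun l => structCoef i j l - (if i ≤ l then i else 0) + (if j ≤ l then j else 0) - (i - j))
    (fun l _ _ => by unfold structCoef; grind) (fun l _ => by unfold structCoef; grind) v
  rw [h4, add_comm j i] at h2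
  convert ((h1.sub h2).add h3).add h5 using 1
  · funext l
    push_cast
    module
  · push_cast
    module

theorem hasSum_structCoef_A_zero (h : IsConstellationSystem b α J A) {i j : ℤ}
    (hi : 0 ≤ i) (hj : 0 ≤ j) (v : V) :
    HasSum (fun l : ℤ => ((structCoef i j l : ℤ) : K) • J (i + j - l) (A 0 l v)) 0 := by
  convert hasSum_zero using 2 with l
  rcases eq_or_ne l 0 with rfl | hl
  · have h1 : structCoef i j 0 = 0 := by
      unfold structCoef
      grind
    simp [h1]
  · simp [h.base_ne l hl]

theorem hasSum_structCoef_A_one_add_one [CharZero K] (h : IsConstellationSystem b α J A)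
    {i j : ℤ} (hi : 0 ≤ i) (hj : 0 ≤ j) (v : V) :
    HasSum (fun l : ℤ => ((structCoef i j l : ℤ) : K) • J (i + j - l) (A 1 (l + 1) v))
      (⁅A 1 (i + 1), A 3 j⁆ v - ⁅A 1 (j + 1), A 3 i⁆ v
        - (b * ((i - j) * (i + j))) • A 1 (i + j + 1) v) := by
  have h1 := h.hasSum_lie_A_one_three (show 0 ≤ i + 1 by omega) hj v
  have h2 := h.hasSum_lie_A_one_three (show 0 ≤ j + 1 by omega) hi v
  have h3 := (h.hasSum_succ (i + j + 1) (by omega) 1 v).smul_discrete ((i : K) - j)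
  have h5 := h.hasSum_zero_of_antisymm (k := i + j + 1)
    (e := fun l => structCoef i j (l - 1) - (if i + 1 ≤ l then i + 1 else 0)
      + (if j + 1 ≤ l then j + 1 else 0) - (i - j))
    (fun l _ _ => by unfold structCoef; grind) (fun l _ => by unfold structCoef; grind) v
  rw [show i + 1 + j = i + j + 1 by ring] at h1
  rw [show j + 1 + i = i + j + 1 by ring] at h2
  refine (Equiv.subRight (1 : ℤ)).hasSum_iff.1 ?_
  convert ((h1.sub h2).add h3).add h5 using 1
  · funext l
    simp only [Function.comp_apply, Equiv.subRight_apply, sub_add_cancel,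
      show i + j - (l - 1) = i + j + 1 - l by ring]
    push_cast
    module
  · push_cast
    module

/-- The operators `D i j l`, with indices counted from `0`. -/
def structOp (b e : K) (J : ℤ → Module.End K V) (i j l : ℤ) : Module.End K V :=
  ((structCoef i j l : ℤ) : K) • J (i + j - l)
    + if l = i + j then (b * ((i - j) * (i + j)) + e * (i - j)) • 1 else 0

theorem hasSum_structOp {i j : ℤ} {w : ℤ → V} {x : V} (e : K)
    (hx : HasSum (fun l : ℤ => ((structCoef i j l : ℤ) : K) • J (i + j - l) (w l)) x) :
    HasSum (fun l => structOp b e J i j l (w l))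
      (x + (b * ((i - j) * (i + j)) + e * (i - j)) • w (i + j)) := by
  convert hx.add (hasSum_ite_eq (i + j)
    ((b * (((i : K) - j) * (i + j)) + e * (i - j)) • w (i + j))) using 1
  funext l
  unfold structOp
  split_ifs with hl
  · rw [hl]
    rfl
  · rw [add_zero, add_zero]
    rfl

/-- The part of the constraint operators of degree one in `t`. -/
def cubicOp (A : ℕ → ℤ → Module.End K V) (e₁ e₂ e₃ : K) (i : ℤ) : Module.End K V :=
  A 3 i + e₁ • A 2 i + e₂ • A 1 i + e₃ • A 0 i

theorem lie_A_zero (h : IsConstellationSystem b α J A) (X : Module.End K V) (i : ℤ) (v : V) :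
    A 0 i (X v) = X (A 0 i v) := by
  rcases eq_or_ne i 0 with rfl | hi
  · simp [h.base_zero]
  · simp [h.base_ne i hi]

theorem lie_A_one_one (h : IsConstellationSystem b α J A) {i j : ℤ} (hi : 0 ≤ i) (hj : 0 ≤ j)
    (v : V) : ⁅A 1 i, A 1 j⁆ v = 0 := by
  have h1 : ⁅A 1 i, A 1 j⁆ v = (α⁻¹ * α⁻¹) • ⁅J i, J j⁆ v := by
    simp only [lie_end_apply, h.A_one hi, h.A_one hj, map_smul]
    module
  rw [h1, h.comm]
  split_ifs with h0
  · obtain rfl : i = 0 := by omega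
    simp
  · simp

theorem hasSum_structOp_cubicOp [CharZero K] (h : IsConstellationSystem b α J A) {i j : ℤ}
    (hi : 0 ≤ i) (hj : 0 ≤ j) (e₁ e₂ e₃ : K) (v : V) :
    HasSum (fun l => structOp b e₁ J i j l (cubicOp A e₁ e₂ e₃ l v))
      (⁅cubicOp A e₁ e₂ e₃ i, cubicOp A e₁ e₂ e₃ j⁆ v) := by
  have h3 := hasSum_structOp (b := b) e₁ (h.hasSum_lie_A_three_three hi hj v)
  have h2 := hasSum_structOp (b := b) e₁ (h.hasSum_structCoef_A_two hi hj v)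
  have h1 := hasSum_structOp (b := b) e₁ (h.hasSum_structCoef_A_one hi hj v)
  have h0 := hasSum_structOp (b := b) e₁ (h.hasSum_structCoef_A_zero hi hj v)
  have l22 := h.lie_A_two_two hi hj v
  have l12 := h.lie_A_one_two hi hj v
  have l21 := h.lie_A_one_two hj hi v
  have l11 := h.lie_A_one_one hi hj v
  have l00 : ((i : K) - j) • A 0 (i + j) v = 0 := by
    by_cases hij : i + j = 0
    · obtain rfl : i = 0 := by omega
      obtain rfl : j = 0 := by omega
      simp
    · simp [h.base_ne _ hij]
  convert (((h3.add (h2.smul_discrete e₁)).add (h1.smul_discrete e₂)).add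
    (h0.smul_discrete e₃)) using 1
  · funext l
    change structOp b e₁ J i j l (A 3 l v + e₁ • A 2 l v + e₂ • A 1 l v + e₃ • A 0 l v) = _
    rw [map_add, map_add, map_add, map_smul, map_smul, map_smul]
  · rw [add_comm j i] at l21
    simp only [lie_end_apply] at l22 l12 l21 l11 ⊢
    simp only [cubicOp, LinearMap.add_apply, LinearMap.smul_apply, map_add, map_smul,
      h.lie_A_zero (A 1 _), h.lie_A_zero (A 2 _), h.lie_A_zero (A 3 _)]
    linear_combination (norm := module) (e₁ * e₁) • l22 + (e₁ * e₂) • l12 - (e₁ * e₂) • l21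
      + (e₂ * e₂) • l11 - (e₃ * (b * (i + j) + e₁)) • l00
      + (e₃ * e₃) • h.lie_A_zero (A 0 j) i v

theorem hasSum_structOp_A_one [CharZero K] (h : IsConstellationSystem b α J A) {i j : ℤ}
    (hi : 0 ≤ i) (hj : 0 ≤ j) (e₁ e₂ e₃ : K) (v : V) :
    HasSum (fun l => structOp b e₁ J i j l (A 1 (l + 1) v))
      (⁅A 1 (i + 1), cubicOp A e₁ e₂ e₃ j⁆ v - ⁅A 1 (j + 1), cubicOp A e₁ e₂ e₃ i⁆ v) := by
  convert hasSum_structOp (b := b) e₁ (h.hasSum_structCoef_A_one_add_one hi hj v) using 1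
  have l12 := h.lie_A_one_two (show 0 ≤ i + 1 by omega) hj v
  have l21 := h.lie_A_one_two (show 0 ≤ j + 1 by omega) hi v
  have l11 := h.lie_A_one_one (show 0 ≤ i + 1 by omega) hj v
  have l11' := h.lie_A_one_one (show 0 ≤ j + 1 by omega) hi v
  rw [show i + 1 + j = i + j + 1 by ring] at l12
  rw [show j + 1 + i = i + j + 1 by ring] at l21
  push_cast at l12 l21
  simp only [lie_end_apply] at l12 l21 l11 l11' ⊢
  simp only [cubicOp, LinearMap.add_apply, LinearMap.smul_apply, map_add, map_smul,
    h.lie_A_zero]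
  linear_combination (norm := module) e₁ • l12 - e₁ • l21 + e₂ • l11 - e₂ • l11'

theorem hasSum_structOp_constraint [CharZero K] (h : IsConstellationSystem b α J A) {i j : ℤ}
    (hi : 0 ≤ i) (hj : 0 ≤ j) (e₁ e₂ e₃ : K) (f g : V) :
    HasSum (fun l => structOp b e₁ J i j l (-A 1 (l + 1) f + cubicOp A e₁ e₂ e₃ l g))
      (⁅cubicOp A e₁ e₂ e₃ i, cubicOp A e₁ e₂ e₃ j⁆ g
        - (⁅A 1 (i + 1), cubicOp A e₁ e₂ e₃ j⁆ f - ⁅A 1 (j + 1), cubicOp A e₁ e₂ e₃ i⁆ f)) := by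
  refine ((h.hasSum_structOp_cubicOp hi hj e₁ e₂ e₃ g).sub
    (h.hasSum_structOp_A_one hi hj e₁ e₂ e₃ f)).congr_fun fun l => ?_
  rw [map_add, map_neg, neg_add_eq_sub]

theorem constraint_of_neg (h : IsConstellationSystem b α J A) {l : ℤ} (hl : l < 0)
    (e₁ e₂ e₃ : K) (f g : V) : -A 1 (l + 1) f + cubicOp A e₁ e₂ e₃ l g = 0 := by
  have h1 : A 1 (l + 1) f = 0 := by
    rcases (show l + 1 ≤ 0 by omega).eq_or_lt with h0 | h0
    · rw [h0, h.A_one_zero]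
    · rw [h.neg 1 _ h0, LinearMap.zero_apply]
  simp [h1, cubicOp, h.neg _ l hl]

end IsConstellationSystem

end Constellation

theorem HasSum.finsum_mem_Ici_one {V : Type*} [AddCommGroup V] [TopologicalSpace V]
    [DiscreteTopology V] {f : ℤ → V} {g : ℕ → V} {x : V} (hf : HasSum f x)
    (hneg : ∀ m < 0, f m = 0) (hg : ∀ n : ℕ, 1 ≤ n → g n = f ((n : ℤ) - 1)) :
    (Set.Ici 1 ∩ Function.support g).Finite ∧ ∑ᶠ n ∈ Set.Ici (1 : ℕ), g n = x := by
  have hinj : Function.Injective fun n : ℕ => (n : ℤ) - 1 := fun m n hmn => by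
    simpa using hmn
  have h1 : HasSum ((Set.Ici (1 : ℕ)).indicator g) x := by
    refine ((hinj.hasSum_iff fun m hm => hneg m ?_).2 hf).congr_fun fun n => ?_
    · by_contra! h0
      exact hm ⟨(m + 1).toNat, by simp; omega⟩
    · rcases Nat.eq_zero_or_pos n with rfl | hn
      · simp [hneg (-1) (by omega)]
      · rw [Set.indicator_of_mem (by exact hn), hg n hn]
        rfl
  have h2 := h1.summable.hasFiniteSupport_of_discreteTopology
  refine ⟨?_, ?_⟩
  · rw [← Set.support_indicator]
    exact h2
  · rw [finsum_mem_def, ← tsum_eq_finsum (L := SummationFilter.unconditional ℕ) h2, h1.tsum_eq]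

theorem hasSum_of_finite_Ici_one {V : Type*} [AddCommGroup V] [TopologicalSpace V]
    [DiscreteTopology V] {f : ℤ → V} {g : ℕ → V} (hfin : (Set.Ici 1 ∩ Function.support g).Finite)
    (hneg : ∀ m < 0, f m = 0) (hg : ∀ n : ℕ, 1 ≤ n → g n = f ((n : ℤ) - 1)) :
    HasSum f (∑ᶠ n ∈ Set.Ici (1 : ℕ), g n) := by
  have hs : Summable f := by
    refine summable_of_hasFiniteSupport ((hfin.image fun n : ℕ => (n : ℤ) - 1).subset fun m hm => ?_)
    have h0 : 0 ≤ m := by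
      by_contra! h0
      exact hm (hneg m h0)
    have h1 : (((m + 1).toNat : ℕ) : ℤ) - 1 = m := by omega
    refine ⟨(m + 1).toNat, ⟨?_, ?_⟩, h1⟩
    · simp only [Set.mem_Ici]
      omega
    · rw [Function.mem_support, hg _ (by omega), h1]
      exact hm
  rw [(hs.hasSum.finsum_mem_Ici_one hneg hg).2]
  exact hs.hasSum

section Currents

variable {K : Type} [Field K]

theorem pderivN_apply (i : ℕ+) (f : Rp K) :
    pderivN K i f = MvPolynomial.pderiv i f := by
  have h : pderivN K i = (MvPolynomial.pderiv i).toLinearMap := dif_pos i.pos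
  rw [h]
  rfl

theorem Jop_of_pos (b : K) (i : ℕ+) (f : Rp K) :
    Jop K b ((i : ℕ) : ℤ) f = ((1 + b) * (i : ℕ)) • MvPolynomial.pderiv i f := by
  rw [Jop, if_pos (by exact_mod_cast i.pos), Int.toNat_natCast, LinearMap.smul_apply,
    pderivN_apply, Int.cast_natCast]

theorem Jop_of_neg (b : K) (i : ℕ+) (f : Rp K) :
    Jop K b (-((i : ℕ) : ℤ)) f = MvPolynomial.X i * f := by
  rw [Jop, if_neg (by omega), neg_neg, Int.toNat_natCast, mulpN, dif_pos i.pos]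
  rfl

theorem Jop_zero (b : K) : Jop K b 0 = 0 := by
  simp [Jop, mulpN]

theorem pderiv_comm (i j : ℕ+) (f : Rp K) :
    MvPolynomial.pderiv i (MvPolynomial.pderiv j f)
      = MvPolynomial.pderiv j (MvPolynomial.pderiv i f) := by
  have h : ⁅MvPolynomial.pderiv (R := K) i, MvPolynomial.pderiv (R := K) j⁆ = 0 := by
    refine MvPolynomial.derivation_ext fun k => ?_
    rw [Derivation.commutator_apply, MvPolynomial.pderiv_X, MvPolynomial.pderiv_X]
    simp only [Pi.single_apply]
    split_ifs <;> simp
  have := congrArg (fun D => D f) h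
  simpa [Derivation.commutator_apply, sub_eq_zero] using this

theorem Int.exists_pnat (m : ℤ) : m = 0 ∨ (∃ i : ℕ+, m = (i : ℕ)) ∨ ∃ i : ℕ+, m = -(i : ℕ) := by
  rcases lt_trichotomy m 0 with hm | hm | hm
  · exact .inr (.inr ⟨⟨(-m).toNat, by omega⟩, by rw [PNat.mk_coe]; omega⟩)
  · exact .inl hm
  · exact .inr (.inl ⟨⟨m.toNat, by omega⟩, by rw [PNat.mk_coe]; omega⟩)

theorem lie_Jop_pos_neg (b : K) (p q : ℕ+) (f : Rp K) :
    ⁅Jop K b ((p : ℕ) : ℤ), Jop K b (-((q : ℕ) : ℤ))⁆ f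
      = if p = q then ((1 + b) * (p : ℕ)) • f else 0 := by
  rw [lie_end_apply, Jop_of_pos, Jop_of_neg, Jop_of_neg, Jop_of_pos, Derivation.leibniz,
    MvPolynomial.pderiv_X, Pi.single_apply]
  by_cases hpq : p = q
  · subst hpq
    simp
  · simp [hpq, Ne.symm hpq]

theorem Jop_comm (b : K) (m n : ℤ) (f : Rp K) :
    ⁅Jop K b m, Jop K b n⁆ f = if m + n = 0 then ((1 + b) * m) • f else 0 := by
  have hpos : ∀ p : ℕ+, (0 : ℤ) < (p : ℕ) := fun p => by exact_mod_cast p.pos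
  rcases Int.exists_pnat m with rfl | ⟨p, rfl⟩ | ⟨p, rfl⟩
  · simp [lie_end_apply, Jop_zero]
  all_goals rcases Int.exists_pnat n with rfl | ⟨q, rfl⟩ | ⟨q, rfl⟩
  all_goals have hp := hpos p
  · simp [lie_end_apply, Jop_zero]
  · have hq := hpos q
    rw [if_neg (by omega), lie_end_apply, Jop_of_pos, Jop_of_pos, Jop_of_pos, Jop_of_pos,
      Derivation.map_smul, Derivation.map_smul, pderiv_comm, smul_comm, sub_self]
  · rw [lie_Jop_pos_neg]
    by_cases hpq : p = q
    · simp [hpq]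
    · have : (p : ℕ) ≠ q := fun h => hpq (PNat.eq h)
      rw [if_neg hpq, if_neg (by omega)]
  · simp [lie_end_apply, Jop_zero]
  · have h1 : ⁅Jop K b (-((p : ℕ) : ℤ)), Jop K b ((q : ℕ) : ℤ)⁆ f
        = -⁅Jop K b ((q : ℕ) : ℤ), Jop K b (-((p : ℕ) : ℤ))⁆ f := by
      rw [lie_end_apply, lie_end_apply, neg_sub]
    rw [h1, lie_Jop_pos_neg]
    by_cases hpq : q = p
    · simp [hpq]
    · have : (q : ℕ) ≠ p := fun h => hpq (PNat.eq h)
      rw [if_neg hpq, if_neg (by omega), neg_zero]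
  · have hq := hpos q
    rw [if_neg (by omega), lie_end_apply, Jop_of_neg, Jop_of_neg, Jop_of_neg, Jop_of_neg,
      mul_left_comm, sub_self]

theorem Jop_eventually_eq_zero (b : K) (f : Rp K) : ∀ᶠ m : ℤ in atTop, Jop K b m f = 0 := by
  have h1 : ∀ᶠ m : ℤ in atTop, ∀ i ∈ f.vars, ((i : ℕ) : ℤ) < m := by
    rw [eventually_all_finset]
    exact fun i _ => eventually_gt_atTop _
  filter_upwards [h1, eventually_gt_atTop 0] with m hm h0
  rcases Int.exists_pnat m with rfl | ⟨p, rfl⟩ | ⟨p, rfl⟩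
  · exact absurd h0 (lt_irrefl 0)
  · rw [Jop_of_pos, MvPolynomial.pderiv_eq_zero_of_notMem_vars fun h => lt_irrefl _ (hm p h),
      smul_zero]
  · omega

/-- The operators `A i s` with indices counted from `0`, extended by zero. -/
def zeroIndexed (A : ℕ → ℕ → Module.End K (Rp K)) (s : ℕ) (i : ℤ) : Module.End K (Rp K) :=
  if i < 0 then 0 else A (i.toNat + 1) s

theorem zeroIndexed_sub_one (A : ℕ → ℕ → Module.End K (Rp K)) (s : ℕ) {n : ℕ} (hn : 1 ≤ n) :
    zeroIndexed A s ((n : ℤ) - 1) = A n s := by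
  rw [zeroIndexed, if_neg (by omega), show ((n : ℤ) - 1).toNat + 1 = n by omega]

theorem isConstellationSystem_zeroIndexed [TopologicalSpace (Rp K)] [DiscreteTopology (Rp K)]
    (b : K) (hb : (1 : K) + b ≠ 0)
    (A : ℕ → ℕ → Module.End K (Rp K))
    (hbase1 : A 1 0 = ((1 : K) + b)⁻¹ • (1 : Module.End K (Rp K)))
    (hbase : ∀ i : ℕ, i ≠ 1 → A i 0 = 0)
    (hfin : ∀ (i s : ℕ) (f : Rp K),
      (Set.Ici 1 ∩ Function.support fun n : ℕ =>
        (Jop K b ((i : ℤ) - (n : ℤ))) ((A n s) f)).Finite)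
    (hrec : ∀ i : ℕ, 1 ≤ i → ∀ (s : ℕ) (f : Rp K),
      (A i (s + 1)) f =
        (∑ᶠ n ∈ Set.Ici (1 : ℕ), (Jop K b ((i : ℤ) - (n : ℤ))) ((A n s) f)) +
          (b * ((i : K) - 1)) • (A i s) f) :
    IsConstellationSystem b (1 + b) (Jop K b) (zeroIndexed A) where
  alpha_ne := hb
  comm := Jop_comm b
  zero := Jop_zero b
  locFin := Jop_eventually_eq_zero b
  neg _ _ hi := if_pos hi
  base_zero := by simpa [zeroIndexed] using hbase1
  base_ne i hi := by
    unfold zeroIndexed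
    split_ifs with h
    · rfl
    · exact hbase _ (by omega)
  hasSum_succ i hi s f := by
    obtain ⟨n, hn, rfl⟩ : ∃ n : ℕ, 1 ≤ n ∧ i = (n : ℤ) - 1 := ⟨(i + 1).toNat, by omega, by omega⟩
    rw [zeroIndexed_sub_one A _ hn, zeroIndexed_sub_one A _ hn, hrec n hn]
    push_cast
    rw [add_sub_cancel_right]
    refine hasSum_of_finite_Ici_one (hfin n s f) ?_ ?_
    · intro m hm
      simp [zeroIndexed, hm]
    · intro m hm
      rw [zeroIndexed_sub_one A _ hm, sub_sub_sub_cancel_right]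

open IsConstellationSystem in
theorem Dcoef_eq_structOp (b e : K) {i j l : ℕ} (hi : 1 ≤ i) (hj : 1 ≤ j) (hl : 1 ≤ l) :
    Dcoef K b i j l 3 + e • Dcoef K b i j l 2
      = structOp b e (Jop K b) ((i : ℤ) - 1) ((j : ℤ) - 1) ((l : ℤ) - 1) := by
  unfold structOp Dcoef
  have hc : (((i : K) - (j : K)) *
          (2 * (if max i j ≤ l then (1 : K) else 0) +
            (if max i j ≤ l ∧ (l : ℤ) ≤ (i : ℤ) + (j : ℤ) - 1 then (1 : K) else 0)) +
        ((((i : ℤ) - (j : ℤ)).sign : K) *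
            ((2 * (l : ℤ) - 3 * (min i j : ℤ) + 1 : ℤ) : K)) *
          (if min i j ≤ l ∧ l < max i j then (1 : K) else 0))
      = ((structCoef ((i : ℤ) - 1) ((j : ℤ) - 1) ((l : ℤ) - 1) : ℤ) : K) := by
    have hz : (((i : ℤ) - (j : ℤ)) *
          (2 * (if max i j ≤ l then 1 else 0) +
            (if max i j ≤ l ∧ (l : ℤ) ≤ (i : ℤ) + (j : ℤ) - 1 then 1 else 0)) +
        (((i : ℤ) - (j : ℤ)).sign * (2 * (l : ℤ) - 3 * (min i j : ℤ) + 1)) *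
          (if min i j ≤ l ∧ l < max i j then 1 else 0))
        = structCoef ((i : ℤ) - 1) ((j : ℤ) - 1) ((l : ℤ) - 1) := by
      unfold structCoef
      rcases lt_trichotomy i j with h | rfl | h
      · rw [Int.sign_eq_neg_one_of_neg (by omega), max_eq_right h.le, min_eq_left h.le,
          min_eq_left (by exact_mod_cast h.le)]
        split_ifs <;> omega
      · simp
      · rw [Int.sign_eq_one_of_pos (by omega), max_eq_left h.le, min_eq_right h.le,
          min_eq_right (by exact_mod_cast h.le)]
        split_ifs <;> omega
    rw [← hz]
    push_cast
    rfl
  simp only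
  rw [hc, show (i : ℤ) + j - 1 - l = (i : ℤ) - 1 + (j - 1) - (l - 1) by ring, add_assoc]
  congr 1
  by_cases h : (l : ℤ) = (i : ℤ) + (j : ℤ) - 1
  · rw [if_pos h, if_pos h, if_pos (by omega), smul_smul, ← add_smul]
    congr 1
    push_cast
    ring
  · rw [if_neg h, if_neg h, if_neg (by omega)]
    simp

theorem pstar_eq_A_one [TopologicalSpace (Rp K)] [DiscreteTopology (Rp K)] {b : K}
    {A : ℕ → ℤ → Module.End K (Rp K)} (h : IsConstellationSystem b (1 + b) (Jop K b) A)
    {i : ℕ} (hi : 1 ≤ i) (f : Rp K) : pstar K i f = A 1 i f := by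
  lift i to ℕ+ using hi
  rw [h.A_one (by omega), Jop_of_pos, pstar, LinearMap.smul_apply, pderivN_apply, smul_smul,
    inv_mul_cancel_left₀ h.alpha_ne]

end Currents

section Constraints

variable {K : Type} [Field K]

theorem liftE_apply (φ : Module.End K (Rp K)) (F : ℕ → Rp K) (n : ℕ) :
    liftE K φ F n = φ (F n) := rfl

theorem tshift_zero (F : ℕ → Rp K) : tshift K F 0 = 0 := rfl

theorem tshift_succ (F : ℕ → Rp K) (n : ℕ) : tshift K F (n + 1) = F n := rfl

/-- The action of the constraint operators on coefficients. -/
theorem Lconstr_apply [TopologicalSpace (Rp K)] [DiscreteTopology (Rp K)] {b : K} (u₁ u₂ u₃ : K)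
    {A : ℕ → ℕ → Module.End K (Rp K)}
    (h : IsConstellationSystem b (1 + b) (Jop K b) (zeroIndexed A)) {i : ℕ} (hi : 1 ≤ i)
    (F : ℕ → Rp K) (n : ℕ) :
    Lconstr K u₁ u₂ u₃ A i F n = -zeroIndexed A 1 ((i : ℤ) - 1 + 1) (F n)
      + IsConstellationSystem.cubicOp (zeroIndexed A) (u₁ + u₂ + u₃)
          (u₁ * u₂ + u₁ * u₃ + u₂ * u₃) (u₁ * u₂ * u₃) ((i : ℤ) - 1) (tshift K F n) := by
  rw [sub_add_cancel, ← pstar_eq_A_one h hi, IsConstellationSystem.cubicOp]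
  simp only [zeroIndexed_sub_one A _ hi]
  cases n with
  | zero => simp [Lconstr, liftE_apply, tshift_zero]
  | succ n => simp [Lconstr, liftE_apply, tshift_succ]

theorem finite_and_finsum_Lconstr [CharZero K] [TopologicalSpace (Rp K)]
    [DiscreteTopology (Rp K)] {b : K} (u₁ u₂ u₃ : K) {A : ℕ → ℕ → Module.End K (Rp K)}
    (h : IsConstellationSystem b (1 + b) (Jop K b) (zeroIndexed A)) {i j : ℕ} (hi : 1 ≤ i)
    (hj : 1 ≤ j) (F : ℕ → Rp K) (n : ℕ) {B : ℤ → Module.End K (Rp K)}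
    (hB : B = IsConstellationSystem.cubicOp (zeroIndexed A) (u₁ + u₂ + u₃)
      (u₁ * u₂ + u₁ * u₃ + u₂ * u₃) (u₁ * u₂ * u₃)) :
    (Set.Ici 1 ∩ Function.support fun l : ℕ =>
      (liftE K (Dcoef K b i j l 3 + (u₁ + u₂ + u₃) • Dcoef K b i j l 2))
        ((Lconstr K u₁ u₂ u₃ A l) F) n).Finite ∧
    ∑ᶠ l ∈ Set.Ici (1 : ℕ), (liftE K (Dcoef K b i j l 3 + (u₁ + u₂ + u₃) • Dcoef K b i j l 2))
        ((Lconstr K u₁ u₂ u₃ A l) F) n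
      = ⁅B ((i : ℤ) - 1), B ((j : ℤ) - 1)⁆ (tshift K F n)
        - (⁅zeroIndexed A 1 ((i : ℤ) - 1 + 1), B ((j : ℤ) - 1)⁆ (F n)
          - ⁅zeroIndexed A 1 ((j : ℤ) - 1 + 1), B ((i : ℤ) - 1)⁆ (F n)) := by
  subst hB
  refine (h.hasSum_structOp_constraint (show 0 ≤ (i : ℤ) - 1 by omega)
    (show 0 ≤ (j : ℤ) - 1 by omega) (u₁ + u₂ + u₃) (u₁ * u₂ + u₁ * u₃ + u₂ * u₃) (u₁ * u₂ * u₃)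
    (F n) (tshift K F n)).finsum_mem_Ici_one (fun m hm => ?_) (fun l hl => ?_)
  · rw [h.constraint_of_neg hm, map_zero]
  · rw [liftE_apply, Dcoef_eq_structOp b _ hi hj hl, Lconstr_apply u₁ u₂ u₃ h hl]

/-- The action of the commutators of constraint operators on coefficients. -/
theorem lie_Lconstr_apply [TopologicalSpace (Rp K)] [DiscreteTopology (Rp K)] {b : K}
    (u₁ u₂ u₃ : K) {A : ℕ → ℕ → Module.End K (Rp K)}
    (h : IsConstellationSystem b (1 + b) (Jop K b) (zeroIndexed A)) {i j : ℕ} (hi : 1 ≤ i)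
    (hj : 1 ≤ j) (F : ℕ → Rp K) {B : ℤ → Module.End K (Rp K)}
    (hB : B = IsConstellationSystem.cubicOp (zeroIndexed A) (u₁ + u₂ + u₃)
      (u₁ * u₂ + u₁ * u₃ + u₂ * u₃) (u₁ * u₂ * u₃)) (n : ℕ) :
    ⁅Lconstr K u₁ u₂ u₃ A i, Lconstr K u₁ u₂ u₃ A j⁆ F n
      = tshift K (fun n => ⁅B ((i : ℤ) - 1), B ((j : ℤ) - 1)⁆ (tshift K F n)
        - (⁅zeroIndexed A 1 ((i : ℤ) - 1 + 1), B ((j : ℤ) - 1)⁆ (F n)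
          - ⁅zeroIndexed A 1 ((j : ℤ) - 1 + 1), B ((i : ℤ) - 1)⁆ (F n))) n := by
  subst hB
  have h1 := h.lie_A_one_one (show 0 ≤ (i : ℤ) - 1 + 1 by omega)
    (show 0 ≤ (j : ℤ) - 1 + 1 by omega) (F n)
  rw [lie_end_apply] at h1
  have h2 : ⁅Lconstr K u₁ u₂ u₃ A i, Lconstr K u₁ u₂ u₃ A j⁆ F n
      = Lconstr K u₁ u₂ u₃ A i (Lconstr K u₁ u₂ u₃ A j F) n
        - Lconstr K u₁ u₂ u₃ A j (Lconstr K u₁ u₂ u₃ A i F) n := rfl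
  rw [h2, Lconstr_apply u₁ u₂ u₃ h hi, Lconstr_apply u₁ u₂ u₃ h hj, Lconstr_apply u₁ u₂ u₃ h hj,
    Lconstr_apply u₁ u₂ u₃ h hi]
  cases n with
  | zero =>
    simp only [tshift_zero, map_zero, map_neg, neg_neg, add_zero]
    exact h1
  | succ n =>
    simp only [tshift_succ, Lconstr_apply u₁ u₂ u₃ h hi, Lconstr_apply u₁ u₂ u₃ h hj,
      lie_end_apply, map_add, map_neg]
    linear_combination (norm := module) h1

end Constraints

end ConstraintAlgebra

/--
**Closure of the constraint algebra for `b`-deformed `3`-constellations.**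
With `A_i(s)` determined by `A₁(0) = (1+b)⁻¹·id`, `A_i(0) = 0` for `i ≠ 1` and the
(locally finite) recursion `A_i(s+1) = Σ_{n≥1} J_{i−n} ∘ A_n(s) + b(i−1)·A_i(s)`, and
`L_i := −p_i^* + t(A_i(3) + e₁A_i(2) + e₂A_i(1) + e₃A_i(0))` in `End_K(R)[t]`, one has for all
`i, j ≥ 1`:
`[L_i, L_j] = t · Σ_{l≥1} (D_{ij,l}(3) + e₁(u₁,u₂,u₃)·D_{ij,l}(2)) ∘ L_l`
(a locally finite sum); the identity in `End_K(R)[t]` is expressed by evaluating both sides on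
every polynomial coefficient sequence `F` (i.e. on every element of `R[t]`).
In particular the constraint operators of the cubic `3`-constellation model are closed under
commutation for every value of `b`.
-/
theorem stmt_11 {K : Type} [Field K] [CharZero K] (b : K) (hb : (1 : K) + b ≠ 0)
    (u₁ u₂ u₃ : K)
    (A : ℕ → ℕ → Module.End K (Rp K))
    (hbase1 : A 1 0 = ((1 : K) + b)⁻¹ • (1 : Module.End K (Rp K)))
    (hbase : ∀ i : ℕ, i ≠ 1 → A i 0 = 0)
    (hfin : ∀ (i s : ℕ) (f : Rp K),
      (Set.Ici 1 ∩ Function.support fun n : ℕ =>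
        (Jop K b ((i : ℤ) - (n : ℤ))) ((A n s) f)).Finite)
    (hrec : ∀ i : ℕ, 1 ≤ i → ∀ (s : ℕ) (f : Rp K),
      (A i (s + 1)) f =
        (∑ᶠ n ∈ Set.Ici (1 : ℕ), (Jop K b ((i : ℤ) - (n : ℤ))) ((A n s) f)) +
          (b * ((i : K) - 1)) • (A i s) f) :
    ∀ i j : ℕ, 1 ≤ i → 1 ≤ j →
      (∀ F : ℕ → Rp K, (Function.support F).Finite →
        ⁅Lconstr K u₁ u₂ u₃ A i, Lconstr K u₁ u₂ u₃ A j⁆ F =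
          tshift K (∑ᶠ l ∈ Set.Ici (1 : ℕ),
            (liftE K (Dcoef K b i j l 3 + (u₁ + u₂ + u₃) • Dcoef K b i j l 2))
              ((Lconstr K u₁ u₂ u₃ A l) F))) ∧
      (∀ F : ℕ → Rp K, (Function.support F).Finite →
        (Set.Ici 1 ∩ Function.support fun l : ℕ =>
          (liftE K (Dcoef K b i j l 3 + (u₁ + u₂ + u₃) • Dcoef K b i j l 2))
            ((Lconstr K u₁ u₂ u₃ A l) F)).Finite) := by
  let _ : TopologicalSpace (Rp K) := ⊥
  have : DiscreteTopology (Rp K) := ⟨rfl⟩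
  have h := isConstellationSystem_zeroIndexed b hb A hbase1 hbase hfin hrec
  intro i j hi hj
  have hsupp : ∀ F : ℕ → Rp K, (Function.support F).Finite →
      (Set.Ici 1 ∩ Function.support fun l : ℕ =>
        (liftE K (Dcoef K b i j l 3 + (u₁ + u₂ + u₃) • Dcoef K b i j l 2))
          ((Lconstr K u₁ u₂ u₃ A l) F)).Finite := by
    intro F hF
    refine ((hF.union (hF.image Nat.succ)).biUnion fun n _ =>
      (finite_and_finsum_Lconstr u₁ u₂ u₃ h hi hj F n rfl).1).subset ?_
    rintro l ⟨hl, hne⟩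
    obtain ⟨n, hn⟩ := Function.ne_iff.1 hne
    refine Set.mem_biUnion (x := n) ?_ ⟨hl, hn⟩
    by_contra hnF
    rw [Set.mem_union, not_or, Function.notMem_support] at hnF
    refine hn ?_
    have ht : tshift K F n = 0 := by
      cases n with
      | zero => rfl
      | succ n =>
        by_contra h0
        exact hnF.2 ⟨n, h0, rfl⟩
    have hL : Lconstr K u₁ u₂ u₃ A l F n = 0 := by
      rw [Lconstr_apply u₁ u₂ u₃ h hl, ht, hnF.1, map_zero, map_zero, neg_zero, add_zero]
    simp only [liftE_apply, hL, map_zero, Pi.zero_apply]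
  refine ⟨fun F hF => funext fun n => ?_, hsupp⟩
  rw [lie_Lconstr_apply u₁ u₂ u₃ h hi hj F rfl n]
  refine congrFun (congrArg (tshift K) (funext fun m => ?_)) n
  rw [← (finite_and_finsum_Lconstr u₁ u₂ u₃ h hi hj F m rfl).2]
  exact ((Pi.evalAddMonoidHom (fun _ : ℕ => Rp K) m).map_finsum_mem' (hsupp F hF)).symm
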